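/- arXiv:2502.16854 — 6 statements merged into one kernel-verified Lean document; each statement's English description precedes it below -/
import Mathlib

section
/- For every real p > 0 and every s ∈ ℝ, one has φ_p''(s)·s² ≤ 6·φ_p(s), where φ_p''(s) = 1 for s ≤ −1/p, φ_p''(s) = −p s for −1/p ≤ s ≤ 0, and φ_p''(s) = 0 for s ≥ 0. -/
/-- The C² regularization `φ_p` of `s ↦ min(s,0)`. -/
noncomputable def phiReg (p s : ℝ) : ℝ :=
  if s ≤ -1/p then s^2/2 + s/(2*p) + 1/(6*p^2)
  else if s ≤ 0 then -p * s^3 / 6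
  else 0

/-- The piecewise second derivative `φ_p''`. -/
noncomputable def phiReg'' (p s : ℝ) : ℝ :=
  if s ≤ -1/p then 1
  else if s ≤ 0 then -p * s
  else 0

/-- For every `p > 0` and every `s ∈ ℝ`, one has `φ_p''(s)·s² ≤ 6·φ_p(s)`. -/
theorem phiReg''_mul_sq_le (p : ℝ) (hp : 0 < p) (s : ℝ) :
    phiReg'' p s * s^2 ≤ 6 * phiReg p s := by
  unfold phiReg'' phiReg
  split_ifs with h1 h2
  · have e1 : s/(2*p) = s * p⁻¹ / 2 := by field_simp
    have e2 : 1/(6*p^2) = (p⁻¹)^2 / 6 := by field_simp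
    have e3 : -1/p = -p⁻¹ := by field_simp
    rw [e1, e2]
    rw [e3] at h1
    have ht : 0 < p⁻¹ := inv_pos.mpr hp
    nlinarith [mul_nonneg (show 0 ≤ -(2*s + p⁻¹) by linarith) (show 0 ≤ -(s + p⁻¹) by linarith)]
  · apply le_of_eq
    ring
  · simp
end

section
/- Let N ≥ 1, let A be a real N×N matrix with A_{ij} ≤ 0 for all i ≠ j and Σ_{j=1}^N A_{ij} ≥ 0 for every i, let Δt > 0, let λ, G ∈ ℝ, and let M̃ = diag(m_1, …, m_N) be a real diagonal matrix. If U_n ∈ ℝ^N has U_{n,i} ≥ 0 for all i and U_{n+1} ∈ ℝ^N satisfies U_{n+1} + Δt·(A U_{n+1}) = exp(λ G √(Δt) M̃ − (1/2) λ² Δt M̃²) U_n, where exp denotes the matrix exponential, then U_{n+1,i} ≥ 0 for all i. Thus the two-step splitting scheme (6.3) preserves nonnegativity unconditionally with respect to Δt. -/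
open NormedSpace

/-- The two-step splitting scheme (6.3) preserves nonnegativity
unconditionally with respect to `Δt`: if `A` has nonpositive off-diagonal
entries and nonnegative row sums, `M̃ = diag(m)` and `U_{n+1} + Δt·A U_{n+1} =
exp(λG√Δt·M̃ − ½λ²Δt·M̃²) U_n` with `U_n ≥ 0`, then `U_{n+1} ≥ 0`. -/
theorem two_step_splitting_nonnegativity (N : ℕ) (hN : 1 ≤ N)
    (A : Matrix (Fin N) (Fin N) ℝ)
    (hoff : ∀ i j, i ≠ j → A i j ≤ 0)
    (hrow : ∀ i, 0 ≤ ∑ j, A i j)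
    (Δt : ℝ) (hΔt : 0 < Δt) (lam G : ℝ) (m : Fin N → ℝ)
    (Un Unp1 : Fin N → ℝ)
    (hUn : ∀ i, 0 ≤ Un i)
    (heq : ∀ i, Unp1 i + Δt * (A.mulVec Unp1) i =
      ((exp ((lam * G * Real.sqrt Δt) • Matrix.diagonal m -
        ((1/2) * lam^2 * Δt) • (Matrix.diagonal m)^2)).mulVec Un) i) :
    ∀ i, 0 ≤ Unp1 i := by
  have hdiag : ((lam * G * Real.sqrt Δt) • Matrix.diagonal m -
        ((1/2) * lam^2 * Δt) • (Matrix.diagonal m)^2) =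
      Matrix.diagonal (fun i => (lam * G * Real.sqrt Δt) * m i -
        ((1/2) * lam^2 * Δt) * (m i)^2) := by
    rw [Matrix.diagonal_pow, ← Matrix.diagonal_smul, ← Matrix.diagonal_smul,
      Matrix.diagonal_sub]
    rfl
  rw [hdiag, Matrix.exp_diagonal] at heq
  have : Nonempty (Fin N) := ⟨⟨0, hN⟩⟩
  obtain ⟨k, hk⟩ := Finite.exists_min Unp1
  have key : 0 ≤ Unp1 k := by
    by_contra hneg
    have hneg : Unp1 k < 0 := not_le.mp hneg
    have h1 : (A.mulVec Unp1) k ≤ (∑ j, A k j) * Unp1 k := by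
      rw [Finset.sum_mul, Matrix.mulVec, dotProduct]
      apply Finset.sum_le_sum
      intro j _
      by_cases hj : k = j
      · subst hj; exact le_refl _
      · exact mul_le_mul_of_nonpos_left (hk j) (hoff k j hj)
    have h2 : (∑ j, A k j) * Unp1 k ≤ 0 :=
      mul_nonpos_of_nonneg_of_nonpos (hrow k) hneg.le
    have h3 : Δt * (A.mulVec Unp1) k ≤ 0 :=
      mul_nonpos_of_nonneg_of_nonpos hΔt.le (h1.trans h2)
    have h4 := heq k
    rw [Matrix.mulVec_diagonal, Pi.coe_exp, ← Real.exp_eq_exp_ℝ] at h4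
    have h5 := mul_nonneg (Real.exp_pos ((lam * G * Real.sqrt Δt) * m k -
        ((1/2) * lam^2 * Δt) * (m k)^2)).le (hUn k)
    linarith
  exact fun i => key.trans (hk i)
end

section
/- Let N ≥ 1, let A be a real N×N matrix with A_{ij} ≤ 0 for all i ≠ j and Σ_{j=1}^N A_{ij} ≥ 0 for every i, let Δt > 0, let λ, G ∈ ℝ, and let M̃ be a real diagonal N×N matrix. Suppose U_n, U_{n+1/3}, U_{n+2/3}, U_{n+1} ∈ ℝ^N satisfy the three-step Strang splitting: U_{n+1/3} + (Δt/2)·(A U_{n+1/3}) = U_n; U_{n+2/3} = exp(λ G √(Δt) M̃ − (1/2) λ² Δt M̃²) U_{n+1/3}; and U_{n+1} + (Δt/2)·(A U_{n+1}) = U_{n+2/3}, where exp is the matrix exponential. If U_{n,i} ≥ 0 for all i, then U_{n+1/3}, U_{n+2/3} and U_{n+1} all have nonnegative components; in particular the scheme (6.4) preserves nonnegativity unconditionally with respect to Δt. -/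
open NormedSpace

theorem implicit_step_nonneg (N : ℕ) (A : Matrix (Fin N) (Fin N) ℝ)
    (hoff : ∀ i j, i ≠ j → A i j ≤ 0) (hrow : ∀ i, 0 ≤ ∑ j, A i j)
    (c : ℝ) (hc : 0 < c) (U V : Fin N → ℝ) (hV : ∀ i, 0 ≤ V i)
    (h : ∀ i, U i + c * (A.mulVec U) i = V i) : ∀ i, 0 ≤ U i := by
  intro i
  haveI : Nonempty (Fin N) := ⟨i⟩
  obtain ⟨k, hk⟩ := Finite.exists_min U
  refine le_trans ?_ (hk i)
  by_contra hneg
  push Not at hneg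
  have h1 : (A.mulVec U) k ≤ ∑ j, A k j * U k := by
    simp only [Matrix.mulVec, dotProduct]
    refine Finset.sum_le_sum fun j _ => ?_
    by_cases hj : k = j
    · subst hj; exact le_rfl
    · exact mul_le_mul_of_nonpos_left (hk j) (hoff k j hj)
  rw [← Finset.sum_mul] at h1
  have h2 : (∑ j, A k j) * U k ≤ 0 := mul_nonpos_of_nonneg_of_nonpos (hrow k) hneg.le
  have h3 : c * (A.mulVec U) k ≤ 0 := mul_nonpos_of_nonneg_of_nonpos hc.le (h1.trans h2)
  have := h k
  have := hV k
  linarith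

/-- The three-step Strang splitting scheme (6.4) preserves nonnegativity
unconditionally with respect to `Δt`. -/
theorem strang_splitting_nonnegativity (N : ℕ) (hN : 1 ≤ N)
    (A : Matrix (Fin N) (Fin N) ℝ)
    (hoff : ∀ i j, i ≠ j → A i j ≤ 0)
    (hrow : ∀ i, 0 ≤ ∑ j, A i j)
    (Δt : ℝ) (hΔt : 0 < Δt) (lam G : ℝ) (M : Matrix (Fin N) (Fin N) ℝ)
    (hM : M.IsDiag)
    (Un Ua Ub Unp1 : Fin N → ℝ)
    (hUn : ∀ i, 0 ≤ Un i)
    (heq1 : ∀ i, Ua i + (Δt/2) * (A.mulVec Ua) i = Un i)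
    (heq2 : Ub = (exp ((lam * G * Real.sqrt Δt) • M -
      ((1/2) * lam^2 * Δt) • M^2)).mulVec Ua)
    (heq3 : ∀ i, Unp1 i + (Δt/2) * (A.mulVec Unp1) i = Ub i) :
    (∀ i, 0 ≤ Ua i) ∧ (∀ i, 0 ≤ Ub i) ∧ (∀ i, 0 ≤ Unp1 i) := by
  have ha := implicit_step_nonneg N A hoff hrow (Δt/2) (by positivity) Ua Un hUn heq1
  have hb : ∀ i, 0 ≤ Ub i := by
    intro i
    obtain ⟨v, rfl⟩ : ∃ v, M = Matrix.diagonal v := ⟨_, hM.diagonal_diag.symm⟩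
    rw [heq2, Matrix.diagonal_pow, ← Matrix.diagonal_smul, ← Matrix.diagonal_smul,
      Matrix.diagonal_sub, Matrix.exp_diagonal, Matrix.mulVec_diagonal, Pi.coe_exp,
      ← Real.exp_eq_exp_ℝ]
    exact mul_nonneg (Real.exp_pos _).le (ha i)
  exact ⟨ha, hb, implicit_step_nonneg N A hoff hrow (Δt/2) (by positivity) Unp1 Ub hb heq3⟩
end

section
/- Let N ≥ 1, let A be a real N×N matrix with A_{ij} ≤ 0 for all i ≠ j and Σ_{j=1}^N A_{ij} ≥ 0 for every i, let Δt > 0, let λ, G¹, G² ∈ ℝ, and let M̃ be a real diagonal N×N matrix. Suppose U_n, U_{n+1/3}, U_{n+2/3}, U_{n+1} ∈ ℝ^N satisfy: U_{n+1/3} = exp(λ G¹ √(Δt/2) M̃ − (1/2) λ² (Δt/2) M̃²) U_n; U_{n+2/3} + Δt·(A U_{n+2/3}) = U_{n+1/3}; and U_{n+1} = exp(λ G² √(Δt/2) M̃ − (1/2) λ² (Δt/2) M̃²) U_{n+2/3}, where exp is the matrix exponential. If U_{n,i} ≥ 0 for all i, then U_{n+1/3}, U_{n+2/3} and U_{n+1}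 all have nonnegative components; in particular the scheme (6.5) preserves nonnegativity unconditionally with respect to Δt. -/
open NormedSpace

theorem exp_diag_nonneg_aux {N : ℕ} (M : Matrix (Fin N) (Fin N) ℝ) (hM : M.IsDiag) (a b : ℝ)
    (U : Fin N → ℝ) (hU : ∀ i, 0 ≤ U i) :
    ∀ i, 0 ≤ ((exp (a • M - b • M^2)).mulVec U) i := by
  intro i
  obtain ⟨d, rfl⟩ : ∃ d, M = Matrix.diagonal d := ⟨_, hM.diagonal_diag.symm⟩
  have h : a • Matrix.diagonal d - b • (Matrix.diagonal d)^2
      = Matrix.diagonal (a • d - b • d^2) := by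
    rw [Matrix.diagonal_pow, ← Matrix.diagonal_smul, ← Matrix.diagonal_smul, Matrix.diagonal_sub]
    rfl
  rw [h, Matrix.exp_diagonal, Matrix.mulVec_diagonal, Pi.coe_exp, ← Real.exp_eq_exp_ℝ]
  exact mul_nonneg (Real.exp_pos _).le (hU i)

/-- The three-step Strang splitting scheme (6.5) preserves nonnegativity
unconditionally with respect to `Δt`. -/
theorem strang_splitting_nonnegativity' (N : ℕ) (hN : 1 ≤ N)
    (A : Matrix (Fin N) (Fin N) ℝ)
    (hoff : ∀ i j, i ≠ j → A i j ≤ 0)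
    (hrow : ∀ i, 0 ≤ ∑ j, A i j)
    (Δt : ℝ) (hΔt : 0 < Δt) (lam G1 G2 : ℝ) (M : Matrix (Fin N) (Fin N) ℝ)
    (hM : M.IsDiag)
    (Un Ua Ub Unp1 : Fin N → ℝ)
    (hUn : ∀ i, 0 ≤ Un i)
    (heq1 : Ua = (exp ((lam * G1 * Real.sqrt (Δt/2)) • M -
      ((1/2) * lam^2 * (Δt/2)) • M^2)).mulVec Un)
    (heq2 : ∀ i, Ub i + Δt * (A.mulVec Ub) i = Ua i)
    (heq3 : Unp1 = (exp ((lam * G2 * Real.sqrt (Δt/2)) • M -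
      ((1/2) * lam^2 * (Δt/2)) • M^2)).mulVec Ub) :
    (∀ i, 0 ≤ Ua i) ∧ (∀ i, 0 ≤ Ub i) ∧ (∀ i, 0 ≤ Unp1 i) := by
  have ha : ∀ i, 0 ≤ Ua i := by
    rw [heq1]
    exact exp_diag_nonneg_aux M hM _ _ Un hUn
  have hb : ∀ i, 0 ≤ Ub i := by
    haveI : Nonempty (Fin N) := ⟨⟨0, hN⟩⟩
    obtain ⟨i, hi⟩ := Finite.exists_min Ub
    suffices h : 0 ≤ Ub i from fun j => h.trans (hi j)
    by_contra! hneg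
    have h1 : (A.mulVec Ub) i ≤ ∑ j, A i j * Ub i := by
      simp only [Matrix.mulVec, dotProduct]
      refine Finset.sum_le_sum fun j _ => ?_
      by_cases hij : i = j
      · rw [hij]
      · exact mul_le_mul_of_nonpos_left (hi j) (hoff i j hij)
    rw [← Finset.sum_mul] at h1
    have h2 := mul_nonpos_of_nonneg_of_nonpos (hrow i) hneg.le
    have h3 := mul_nonpos_of_nonneg_of_nonpos hΔt.le (h1.trans h2)
    linarith [heq2 i, ha i]
  refine ⟨ha, hb, ?_⟩
  rw [heq3]
  exact exp_diag_nonneg_aux M hM _ _ Ub hb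
end

section
/- Let N ≥ 1, let A be a real N×N matrix with A_{ij} ≤ 0 for all i ≠ j and Σ_{j=1}^N A_{ij} ≥ 0 for every i, let Δt > 0, λ, G ∈ ℝ, and let m_1, …, m_N ∈ ℝ with |λ|·√(Δt)·|m_i| ≤ 1 for every i, and set M̃ = diag(m_1, …, m_N). If U_n ∈ ℝ^N has U_{n,i} ≥ 0 for all i and U_{n+1} ∈ ℝ^N satisfies the fully implicit Euler–Milstein step U_{n+1} + Δt·(A U_{n+1}) = U_n + λ √(Δt) G · (M̃ U_n) + (1/2) λ² Δt (G² − 1) · (M̃² U_n), then U_{n+1,i} ≥ 0 for all i. -/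
/-- If `|λ|·√Δt·|m_i| ≤ 1` for all `i`, then the fully implicit
Euler–Milstein step of the mass-lumped finite element method preserves
nonnegativity. -/
theorem implicit_euler_milstein_nonnegativity (N : ℕ) (hN : 1 ≤ N)
    (A : Matrix (Fin N) (Fin N) ℝ)
    (hoff : ∀ i j, i ≠ j → A i j ≤ 0)
    (hrow : ∀ i, 0 ≤ ∑ j, A i j)
    (Δt : ℝ) (hΔt : 0 < Δt) (lam G : ℝ) (m : Fin N → ℝ)
    (hm : ∀ i, |lam| * Real.sqrt Δt * |m i| ≤ 1)
    (Un Unp1 : Fin N → ℝ)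
    (hUn : ∀ i, 0 ≤ Un i)
    (heq : ∀ i, Unp1 i + Δt * (A.mulVec Unp1) i =
      Un i + lam * Real.sqrt Δt * G * ((Matrix.diagonal m).mulVec Un) i +
      (1/2) * lam^2 * Δt * (G^2 - 1) * (((Matrix.diagonal m)^2).mulVec Un) i) :
    ∀ i, 0 ≤ Unp1 i := by
  haveI : Nonempty (Fin N) := ⟨⟨0, hN⟩⟩
  obtain ⟨k, hk⟩ := Finite.exists_min Unp1
  suffices h : 0 ≤ Unp1 k from fun i => h.trans (hk i)
  by_contra hneg
  have hneg' : Unp1 k < 0 := not_le.mp hneg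
  have hA : (A.mulVec Unp1) k ≤ 0 := by
    have h1 : (A.mulVec Unp1) k ≤ ∑ j, A k j * Unp1 k := by
      simp only [Matrix.mulVec, dotProduct]
      refine Finset.sum_le_sum fun j _ => ?_
      by_cases hkj : k = j
      · subst hkj; exact le_rfl
      · exact mul_le_mul_of_nonpos_left (hk j) (hoff k j hkj)
    rw [← Finset.sum_mul] at h1
    exact h1.trans (mul_nonpos_of_nonneg_of_nonpos (hrow k) hneg'.le)
  have hs : Real.sqrt Δt ^ 2 = Δt := Real.sq_sqrt hΔt.le
  have ha : (lam * Real.sqrt Δt * m k) ^ 2 ≤ 1 := by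
    rw [sq_le_one_iff_abs_le_one, abs_mul, abs_mul, abs_of_nonneg (Real.sqrt_nonneg Δt)]
    exact hm k
  have he := heq k
  rw [Matrix.diagonal_pow, Matrix.mulVec_diagonal, Matrix.mulVec_diagonal, Pi.pow_apply] at he
  have hR : Un k + lam * Real.sqrt Δt * G * (m k * Un k) +
      (1/2) * lam^2 * Δt * (G^2 - 1) * (m k ^ 2 * Un k) =
      Un k * (((1 + lam * Real.sqrt Δt * m k * G) ^ 2 +
        (1 - (lam * Real.sqrt Δt * m k) ^ 2)) / 2) := by
    linear_combination (-(1/2) * lam^2 * (G^2 - 1) * (m k ^ 2 * Un k)) * hs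
  have hpos : 0 ≤ Un k * (((1 + lam * Real.sqrt Δt * m k * G) ^ 2 +
        (1 - (lam * Real.sqrt Δt * m k) ^ 2)) / 2) :=
    mul_nonneg (hUn k) (by nlinarith [sq_nonneg (1 + lam * Real.sqrt Δt * m k * G)])
  have hd : Δt * (A.mulVec Unp1) k ≤ 0 := mul_nonpos_of_nonneg_of_nonpos hΔt.le hA
  linarith
end

section
/- Let N ≥ 1 and let S be a symmetric real N×N matrix with S_{ij} ≤ 0 for all i ≠ j and Σ_{j=1}^N S_{ij} ≥ 0 for every i. Let g : ℝ → ℝ be monotonically nondecreasing with g(0) = 0. Then for every U ∈ ℝ^N, Σ_{i=1}^N Σ_{j=1}^N g(U_i) S_{ij} U_j ≥ 0. -/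
/-- Discrete form of the key inequality `∫ ∇u_h · ∇(π_h[g(u_h)]) ≥ 0`: if `S`
is symmetric with nonpositive off-diagonal entries and nonnegative row sums,
and `g` is monotonically nondecreasing with `g(0) = 0`, then
`Σ_i Σ_j g(U_i) S_{ij} U_j ≥ 0`. -/
theorem stiffness_monotone_nonneg (N : ℕ) (hN : 1 ≤ N)
    (S : Matrix (Fin N) (Fin N) ℝ)
    (hsymm : S.IsSymm)
    (hoff : ∀ i j, i ≠ j → S i j ≤ 0)
    (hrow : ∀ i, 0 ≤ ∑ j, S i j)
    (g : ℝ → ℝ) (hg : Monotone g) (hg0 : g 0 = 0)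
    (U : Fin N → ℝ) :
    0 ≤ ∑ i, ∑ j, g (U i) * S i j * U j := by
  have h1 : ∑ i, ∑ j, g (U i) * S i j * U j = ∑ i, ∑ j, g (U j) * S i j * U i := by
    rw [Finset.sum_comm]
    refine Finset.sum_congr rfl fun i _ => Finset.sum_congr rfl fun j _ => ?_
    rw [hsymm.apply]
  have h2 : ∑ i, ∑ j, S i j * (g (U i) * U i) = ∑ i, ∑ j, S i j * (g (U j) * U j) := by
    rw [Finset.sum_comm]
    refine Finset.sum_congr rfl fun i _ => Finset.sum_congr rfl fun j _ => ?_
    rw [hsymm.apply]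
  have h3 : 0 ≤ ∑ i, ∑ j, S i j * (g (U i) * U i) := by
    refine Finset.sum_nonneg fun i _ => ?_
    rw [← Finset.sum_mul]
    refine mul_nonneg (hrow i) ?_
    rcases le_total 0 (U i) with h | h
    · exact mul_nonneg (hg0 ▸ hg h) h
    · exact mul_nonneg_of_nonpos_of_nonpos (hg0 ▸ hg h) h
  have h4 : 0 ≤ ∑ i, ∑ j, -(S i j * ((g (U i) - g (U j)) * (U i - U j))) := by
    refine Finset.sum_nonneg fun i _ => Finset.sum_nonneg fun j _ => ?_
    by_cases hij : i = j
    · simp [hij]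
    · have h : 0 ≤ (g (U i) - g (U j)) * (U i - U j) := by
        rcases le_total (U i) (U j) with h | h
        · exact mul_nonneg_of_nonpos_of_nonpos (sub_nonpos.2 (hg h)) (sub_nonpos.2 h)
        · exact mul_nonneg (sub_nonneg.2 (hg h)) (sub_nonneg.2 h)
      exact neg_nonneg.2 (mul_nonpos_of_nonpos_of_nonneg (hoff i j hij) h)
  have h5 : ∑ i, ∑ j, -(S i j * ((g (U i) - g (U j)) * (U i - U j)))
      = ∑ i, ∑ j, g (U i) * S i j * U j + ∑ i, ∑ j, g (U j) * S i j * U i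
        - ∑ i, ∑ j, S i j * (g (U i) * U i) - ∑ i, ∑ j, S i j * (g (U j) * U j) := by
    simp only [← Finset.sum_add_distrib, ← Finset.sum_sub_distrib]
    refine Finset.sum_congr rfl fun i _ => Finset.sum_congr rfl fun j _ => ?_
    ring
  linarith
end
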